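/- For the blow-up S_8 of ℙ² in 8 points in general position, Peyre's constant is α(S_8) = 1; that is, 9 · vol{x ∈ ℝ⁹ : B(E, x) ≥ 0 for every (−1)-class E, and 0 ≤ B(−K_8, x) ≤ 1} = 1, where vol is the standard Lebesgue measure on ℝ⁹. -/

import Mathlib

open scoped BigOperators
open MeasureTheory

/-- Intersection form on `ℤ^(n+1)` with basis `H, E₁, …, E_n`:
`B(x,y) = x₀y₀ - x₁y₁ - ⋯ - x_n y_n` (written as `2x₀y₀ - ∑ᵢ xᵢyᵢ`). -/
def interZ {n : ℕ} (x y : Fin (n + 1) → ℤ) : ℤ :=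
  2 * x 0 * y 0 - ∑ i, x i * y i

/-- The real intersection form on `ℝ^(n+1)`. -/
def interR {n : ℕ} (x y : Fin (n + 1) → ℝ) : ℝ :=
  2 * x 0 * y 0 - ∑ i, x i * y i

/-- The anticanonical class `-K = (3, -1, …, -1)`. -/
def antiK (n : ℕ) : Fin (n + 1) → ℤ := fun i => if i = 0 then 3 else -1

/-- The anticanonical class as a real vector. -/
def antiKR (n : ℕ) : Fin (n + 1) → ℝ := fun i => if i = 0 then 3 else -1

/-- A `(-1)`-class: `B(E,E) = -1` and `B(-K,E) = 1`. -/
def IsMinusOneClass {n : ℕ} (E : Fin (n + 1) → ℤ) : Prop :=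
  interZ E E = -1 ∧ interZ (antiK n) E = 1

/-- The nef cone: real vectors pairing nonnegatively with every `(-1)`-class. -/
def NefCone (n : ℕ) : Set (Fin (n + 1) → ℝ) :=
  {x | ∀ E : Fin (n + 1) → ℤ, IsMinusOneClass E → 0 ≤ interR (fun i => (E i : ℝ)) x}

/-- Lists of `n` integers in `[-7, 7]` with sum `s` and sum of squares `q`, found by a search that is
pruned with the Cauchy–Schwarz inequality. -/
def sumSqLists : ℕ → ℤ → ℤ → List (List ℤ)
  | 0, s, q => if s = 0 ∧ q = 0 then [[]] else []
  | n + 1, s, q =>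
    if ((n : ℤ) + 1) * q < s * s then [] else
      [-7, -6, -5, -4, -3, -2, -1, 0, 1, 2, 3, 4, 5, 6, 7].flatMap fun a =>
        (sumSqLists n (s - a) (q - a * a)).map (a :: ·)

theorem ofFn_mem_sumSqLists (n : ℕ) (f : Fin n → ℤ) (hf : ∑ i, f i * f i ≤ 50) :
    List.ofFn f ∈ sumSqLists n (∑ i, f i) (∑ i, f i * f i) := by
  induction n with
  | zero => simp [sumSqLists]
  | succ n ih =>
    have hcs : (∑ i, f i) * ∑ i, f i ≤ ((n : ℤ) + 1) * ∑ i, f i * f i := by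
      have := sq_sum_le_card_mul_sum_sq (s := Finset.univ) (f := f)
      simpa [sq] using this
    have htail : 0 ≤ ∑ i : Fin n, f i.succ * f i.succ :=
      Finset.sum_nonneg fun i _ => mul_self_nonneg _
    have hmem := ih (fun i => f i.succ) (by
      rw [Fin.sum_univ_succ] at hf
      nlinarith [mul_self_nonneg (f 0)])
    have hle : f 0 * f 0 ≤ 50 := by
      rw [Fin.sum_univ_succ] at hf
      linarith
    have h1 : -7 ≤ f 0 := by nlinarith
    have h2 : f 0 ≤ 7 := by nlinarith
    rw [sumSqLists, if_neg hcs.not_gt, List.ofFn_succ]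
    simp only [List.mem_flatMap, List.mem_map]
    refine ⟨f 0, ?_, List.ofFn fun i => f i.succ, ?_, rfl⟩
    · generalize f 0 = a at h1 h2
      interval_cases a <;> simp
    · simpa [Fin.sum_univ_succ] using hmem

/-- The coordinate lists of the `(-1)`-classes. -/
def minusOneLists : List (List ℤ) :=
  [-1, 0, 1, 2, 3, 4, 5, 6, 7].flatMap fun d =>
    (sumSqLists 8 (1 - 3 * d) (d * d + 1)).map (d :: ·)

/-- The vector with a given list of coordinates. -/
def vecOfList (l : List ℤ) : Fin (8 + 1) → ℤ := fun i => l.getD i 0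

theorem vecOfList_ofFn (E : Fin (8 + 1) → ℤ) : vecOfList (List.ofFn E) = E := by
  funext i
  simp only [vecOfList, List.getD_eq_getElem?_getD, List.getElem?_ofFn, i.is_lt, dif_pos,
    Option.getD_some]

theorem IsMinusOneClass.ofFn_mem {E : Fin (8 + 1) → ℤ} (hE : IsMinusOneClass E) :
    List.ofFn E ∈ minusOneLists := by
  obtain ⟨h1, h2⟩ := hE
  have hs : ∑ i : Fin 8, E i.succ = 1 - 3 * E 0 := by
    simp only [interZ, antiK, Fin.sum_univ_succ (n := 8), Fin.succ_ne_zero, if_true, if_false,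
      neg_one_mul, Finset.sum_neg_distrib] at h2
    linarith
  have hq : ∑ i : Fin 8, E i.succ * E i.succ = E 0 * E 0 + 1 := by
    simp only [interZ, Fin.sum_univ_succ (n := 8)] at h1
    linarith
  have hcs := sq_sum_le_card_mul_sum_sq (s := Finset.univ) (f := fun i : Fin 8 => E i.succ)
  simp only [sq, hs, hq, Finset.card_univ, Fintype.card_fin] at hcs
  push_cast at hcs
  have hd1 : -1 ≤ E 0 := by nlinarith
  have hd2 : E 0 ≤ 7 := by nlinarith
  have hmem := ofFn_mem_sumSqLists 8 (fun i => E i.succ) (by rw [hq]; nlinarith)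
  rw [hs, hq] at hmem
  rw [List.ofFn_succ, minusOneLists]
  simp only [List.mem_flatMap, List.mem_map]
  refine ⟨E 0, ?_, _, hmem, rfl⟩
  generalize E 0 = d at hd1 hd2
  interval_cases d <;> simp

instance {n : ℕ} (E : Fin (n + 1) → ℤ) : Decidable (IsMinusOneClass E) :=
  inferInstanceAs (Decidable (_ ∧ _))

theorem isMinusOneClass_vecOfList :
    ∀ l ∈ minusOneLists, IsMinusOneClass (vecOfList l) := by
  decide +kernel

/-- The `(-1)`-classes. -/
def minusOneClasses : Finset (Fin (8 + 1) → ℤ) := (minusOneLists.map vecOfList).toFinset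

theorem mem_minusOneClasses {E : Fin (8 + 1) → ℤ} : E ∈ minusOneClasses ↔ IsMinusOneClass E := by
  simp only [minusOneClasses, List.mem_toFinset, List.mem_map]
  refine ⟨?_, fun h => ⟨_, h.ofFn_mem, vecOfList_ofFn E⟩⟩
  rintro ⟨l, hl, rfl⟩
  exact isMinusOneClass_vecOfList l hl

theorem IsMinusOneClass.exists_list {E : Fin (8 + 1) → ℤ} (hE : IsMinusOneClass E) :
    ∃ l ∈ minusOneLists, vecOfList l = E :=
  ⟨_, hE.ofFn_mem, vecOfList_ofFn E⟩

/-- The `(-1)`-classes involving only the first `r` exceptional curves, that is, those of `S_r`. -/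
def classesUpTo (r : ℕ) : Finset (Fin (8 + 1) → ℤ) :=
  minusOneClasses.filter fun E => ∀ i : Fin (8 + 1), r < i → E i = 0

theorem mem_classesUpTo {r : ℕ} {E : Fin (8 + 1) → ℤ} :
    E ∈ classesUpTo r ↔ IsMinusOneClass E ∧ ∀ i : Fin (8 + 1), r < i → E i = 0 := by
  rw [classesUpTo, Finset.mem_filter, mem_minusOneClasses]

theorem classesUpTo_mono {r s : ℕ} (h : r ≤ s) : classesUpTo r ⊆ classesUpTo s := fun E hE => by
  rw [mem_classesUpTo] at hE ⊢
  exact ⟨hE.1, fun i hi => hE.2 i (h.trans_lt hi)⟩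

theorem nodup_minusOneClasses : (minusOneLists.map vecOfList).Nodup := by
  refine List.Nodup.of_map
    (fun E => E 0 + 10 * (E 1 + 10 * (E 2 + 10 * (E 3 + 10 * (E 4 + 10 * (E 5 + 10 * (E 6 +
      10 * (E 7 + 10 * E 8)))))))) ?_
  decide +kernel

theorem card_classesUpTo (r : ℕ) : (classesUpTo r).card =
    ((minusOneLists.map vecOfList).filter
      fun E => ∀ i : Fin (8 + 1), r < i → E i = 0).length := by
  rw [classesUpTo, minusOneClasses, List.filter_toFinset,
    List.toFinset_card_of_nodup (nodup_minusOneClasses.filter _)]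

theorem card_classesUpTo_three : (classesUpTo 3).card = 6 := by
  rw [card_classesUpTo]; decide +kernel

theorem card_classesUpTo_four : (classesUpTo 4).card = 10 := by
  rw [card_classesUpTo]; decide +kernel

theorem card_classesUpTo_five : (classesUpTo 5).card = 16 := by
  rw [card_classesUpTo]; decide +kernel

theorem card_classesUpTo_six : (classesUpTo 6).card = 27 := by
  rw [card_classesUpTo]; decide +kernel

theorem card_classesUpTo_seven : (classesUpTo 7).card = 56 := by
  rw [card_classesUpTo]; decide +kernel

theorem card_classesUpTo_eight : (classesUpTo 8).card = 240 := by
  rw [card_classesUpTo]; decide +kernel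

/-- The pairing of a `(-1)`-class with each fundamental weight is nonnegative. -/
theorem IsMinusOneClass.weight_nonneg {E : Fin (8 + 1) → ℤ} (hE : IsMinusOneClass E) :
    0 ≤ E 0 ∧ 0 ≤ E 0 + E 1 ∧ 0 ≤ 2 * E 0 + E 1 + E 2 ∧ 0 ≤ 3 * E 0 + E 1 + E 2 + E 3 ∧
    0 ≤ 3 * E 0 + E 1 + E 2 + E 3 + E 4 ∧ 0 ≤ 3 * E 0 + E 1 + E 2 + E 3 + E 4 + E 5 ∧
    0 ≤ 3 * E 0 + E 1 + E 2 + E 3 + E 4 + E 5 + E 6 ∧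
    0 ≤ 3 * E 0 + E 1 + E 2 + E 3 + E 4 + E 5 + E 6 + E 7 := by
  obtain ⟨l, hl, rfl⟩ := hE.exists_list
  clear hE
  revert l
  decide +kernel

theorem IsMinusOneClass.apply_le_one {E : Fin (8 + 1) → ℤ} (hE : IsMinusOneClass E)
    {r : Fin (8 + 1)} (hr : r ≠ 0) : E r ≤ 1 ∧ (E r = 1 → E = Pi.single r 1) := by
  obtain ⟨l, hl, rfl⟩ := hE.exists_list
  clear hE
  revert l r
  decide +kernel

/-- For `3 ≤ r`, any class in `classesUpTo r` other than `E_r` is orthogonal to a class that has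
smaller intersection with `E_r`. -/
theorem exists_orthogonal_of_mem_classesUpTo {r : Fin (8 + 1)} (hr : 3 ≤ r)
    {E : Fin (8 + 1) → ℤ} (hE : E ∈ classesUpTo r) (hEr : E r ≠ 1) :
    ∃ F ∈ classesUpTo r, interZ E F = 0 ∧ E r < F r := by
  have key : ∀ l ∈ minusOneLists, ∀ r : Fin (8 + 1), 3 ≤ r →
      (∀ i : Fin (8 + 1), r < i → vecOfList l i = 0) → vecOfList l r ≠ 1 →
      ∃ m ∈ minusOneLists, vecOfList l r < vecOfList m r ∧
        (∀ i : Fin (8 + 1), r < i → vecOfList m i = 0) ∧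
        interZ (vecOfList l) (vecOfList m) = 0 := by
    decide +kernel
  rw [mem_classesUpTo] at hE
  obtain ⟨l, hl, rfl⟩ := hE.1.exists_list
  obtain ⟨m, hm, h1, h2, h3⟩ := key l hl r hr (fun i hi => hE.2 i hi) hEr
  exact ⟨vecOfList m, mem_classesUpTo.2 ⟨isMinusOneClass_vecOfList m hm, fun i hi => h2 i hi⟩, h3, h1⟩

/-- The class `E` as a real vector. -/
def toReal (E : Fin (8 + 1) → ℤ) : Fin (8 + 1) → ℝ := fun i => E i

/-- The real intersection form as a bilinear form. -/
def interForm : LinearMap.BilinForm ℝ (Fin (8 + 1) → ℝ) :=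
  LinearMap.mk₂ ℝ interR
    (fun x y z => by simp [interR, Fin.sum_univ_succ]; ring)
    (fun c x y => by simp [interR, Fin.sum_univ_succ]; ring)
    (fun x y z => by simp [interR, Fin.sum_univ_succ]; ring)
    (fun c x y => by simp [interR, Fin.sum_univ_succ]; ring)

@[simp] theorem interForm_apply (x y : Fin (8 + 1) → ℝ) : interForm x y = interR x y := rfl

theorem interR_comm (x y : Fin (8 + 1) → ℝ) : interR x y = interR y x := by
  simp only [interR, mul_comm (x _)]
  ring_nf

theorem interZ_comm (E F : Fin (8 + 1) → ℤ) : interZ E F = interZ F E := by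
  simp only [interZ, mul_comm (E _)]
  ring_nf

theorem interZ_sub_left (E F G : Fin (8 + 1) → ℤ) :
    interZ (E - F) G = interZ E G - interZ F G := by
  simp only [interZ, Pi.sub_apply, sub_mul, mul_sub, Finset.sum_sub_distrib]
  ring

theorem interR_toReal (E F : Fin (8 + 1) → ℤ) :
    interR (toReal E) (toReal F) = (interZ E F : ℝ) := by
  simp [interR, interZ, toReal]

theorem toReal_antiK : toReal (antiK 8) = antiKR 8 := by
  funext i
  simp only [toReal, antiK, antiKR]
  split_ifs <;> simp

theorem toReal_injective : Function.Injective toReal := fun E F h => by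
  funext i
  exact Int.cast_injective (congrFun h i)

theorem interR_single {i : Fin (8 + 1)} (hi : i ≠ 0) (x : Fin (8 + 1) → ℝ) :
    interR (Pi.single i 1) x = -x i := by
  simp [interR, Pi.single_apply, hi.symm]

theorem toReal_single (i : Fin (8 + 1)) : toReal (Pi.single i 1) = Pi.single i 1 := by
  funext j
  by_cases h : j = i
  · subst h; simp [toReal]
  · simp [toReal, h]

theorem isMinusOneClass_iff (E : Fin (8 + 1) → ℤ) : IsMinusOneClass E ↔
    interR (toReal E) (toReal E) = -1 ∧ interR (antiKR 8) (toReal E) = 1 := by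
  rw [IsMinusOneClass, ← toReal_antiK, interR_toReal, interR_toReal]
  norm_cast

/-- The isometries of the Picard lattice of `S_8` that fix the anticanonical class and `E_i` for
`r < i`; this is the Weyl group of `S_r`. -/
def weylGroup (r : ℕ) : Subgroup ((Fin (8 + 1) → ℝ) ≃ₗ[ℝ] (Fin (8 + 1) → ℝ)) where
  carrier := {g | (∀ x y, interR (g x) (g y) = interR x y) ∧ g (antiKR 8) = antiKR 8 ∧
    (∀ i : Fin (8 + 1), r < i → g (Pi.single i 1) = Pi.single i 1) ∧
    (∀ x, g x ∈ Set.range toReal ↔ x ∈ Set.range toReal) ∧ LinearEquiv.det g ^ 2 = 1}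
  one_mem' := by simp
  mul_mem' := by
    rintro g h ⟨g1, g2, g3, g4, g5⟩ ⟨h1, h2, h3, h4, h5⟩
    refine ⟨fun x y => ?_, ?_, fun i hi => ?_, fun x => ?_, ?_⟩
    · simp only [LinearEquiv.mul_apply, g1, h1]
    · rw [LinearEquiv.mul_apply, h2, g2]
    · rw [LinearEquiv.mul_apply, h3 i hi, g3 i hi]
    · rw [LinearEquiv.mul_apply, g4, h4]
    · rw [map_mul, mul_pow, g5, h5, one_mul]
  inv_mem' := by
    rintro g ⟨g1, g2, g3, g4, g5⟩
    have hg : ∀ x, g (g⁻¹ x) = x := g.apply_symm_apply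
    refine ⟨fun x y => ?_, ?_, fun i hi => ?_, fun x => ?_, ?_⟩
    · rw [← g1, hg, hg]
    · exact g.injective (by rw [hg, g2])
    · exact g.injective (by rw [hg, g3 i hi])
    · rw [← g4, hg]
    · rw [map_inv, inv_pow, g5, inv_one]

theorem weylGroup_mono {r s : ℕ} (h : r ≤ s) : weylGroup r ≤ weylGroup s :=
  fun _ ⟨g1, g2, g3, g4⟩ => ⟨g1, g2, fun i hi => g3 i (h.trans_lt hi), g4⟩

theorem interR_inv_left {r : ℕ} {g : (Fin (8 + 1) → ℝ) ≃ₗ[ℝ] (Fin (8 + 1) → ℝ)}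
    (hg : g ∈ weylGroup r) (x y : Fin (8 + 1) → ℝ) : interR (g⁻¹ x) y = interR x (g y) := by
  rw [← hg.1]
  exact congrArg (interR · (g y)) (g.apply_symm_apply x)

/-- The Weyl group permutes the `(-1)`-classes. -/
theorem exists_mem_classesUpTo_of_mem_weylGroup {r : ℕ}
    {g : (Fin (8 + 1) → ℝ) ≃ₗ[ℝ] (Fin (8 + 1) → ℝ)} (hg : g ∈ weylGroup r)
    {E : Fin (8 + 1) → ℤ} (hE : E ∈ classesUpTo r) :
    ∃ F ∈ classesUpTo r, toReal F = g (toReal E) := by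
  obtain ⟨F, hF⟩ := (hg.2.2.2.1 (toReal E)).2 ⟨E, rfl⟩
  refine ⟨F, ?_, hF⟩
  rw [mem_classesUpTo, isMinusOneClass_iff] at hE ⊢
  refine ⟨⟨?_, ?_⟩, fun i hi => ?_⟩
  · rw [hF, hg.1, hE.1.1]
  · rw [hF, ← hg.2.1, hg.1, hE.1.2]
  · have hi0 : i ≠ 0 := by rintro rfl; simp at hi
    have h1 := interR_single hi0 (toReal F)
    rw [hF, ← hg.2.2.1 i hi, hg.1, interR_single hi0, ← hF, neg_inj] at h1
    have h2 : toReal E i = 0 := by rw [toReal, hE.2 i hi, Int.cast_zero]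
    rw [h2] at h1
    exact Int.cast_eq_zero.1 h1.symm

theorem exists_mem_classesUpTo_interR_eq {r : ℕ}
    {g : (Fin (8 + 1) → ℝ) ≃ₗ[ℝ] (Fin (8 + 1) → ℝ)} (hg : g ∈ weylGroup r)
    {E : Fin (8 + 1) → ℤ} (hE : E ∈ classesUpTo r) :
    ∃ F ∈ classesUpTo r, ∀ x, interR (toReal E) (g x) = interR (toReal F) x := by
  obtain ⟨F, hF, hFE⟩ := exists_mem_classesUpTo_of_mem_weylGroup (inv_mem hg) hE
  exact ⟨F, hF, fun x => by rw [hFE, interR_inv_left hg]⟩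

theorem volume_preimage_of_mem_weylGroup {r : ℕ}
    {g : (Fin (8 + 1) → ℝ) ≃ₗ[ℝ] (Fin (8 + 1) → ℝ)} (hg : g ∈ weylGroup r)
    (s : Set (Fin (8 + 1) → ℝ)) : volume (g ⁻¹' s) = volume s := by
  have h : |LinearMap.det (g.symm : (Fin (8 + 1) → ℝ) →ₗ[ℝ] (Fin (8 + 1) → ℝ))| = 1 := by
    rw [← LinearEquiv.coe_det, ← pow_eq_one_iff_of_nonneg (abs_nonneg _) two_ne_zero, sq_abs,
      ← Units.val_pow_eq_pow_val]
    exact Units.val_eq_one.2 (inv_mem hg).2.2.2.2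
  rw [Measure.addHaar_preimage_linearEquiv, h, ENNReal.ofReal_one, one_mul]

/-- The reflection in a root that is orthogonal to `E_i` for `r < i` lies in the Weyl group. -/
theorem exists_reflection_mem_weylGroup {r : ℕ} {α : Fin (8 + 1) → ℤ} (hα : interZ α α = -2)
    (hK : interZ (antiK 8) α = 0) (hr : ∀ i : Fin (8 + 1), r < i → α i = 0) :
    ∃ g ∈ weylGroup r, ∀ x, g x = x + interR (toReal α) x • toReal α := by
  have h2 : (-interForm (toReal α)) (toReal α) = 2 := by
    rw [LinearMap.neg_apply, interForm_apply, interR_toReal, hα]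
    norm_num
  have hKα : interR (toReal α) (antiKR 8) = 0 := by
    rw [interR_comm, ← toReal_antiK, interR_toReal, hK, Int.cast_zero]
  have happly : ∀ x, Module.reflection h2 x = x + interR (toReal α) x • toReal α := fun x => by
    simp [Module.reflection_apply]
  have hinv : ∀ x, Module.reflection h2 (Module.reflection h2 x) = x :=
    Module.involutive_reflection h2
  have hrange : ∀ x ∈ Set.range toReal, Module.reflection h2 x ∈ Set.range toReal := by
    rintro _ ⟨E, rfl⟩
    refine ⟨E + interZ α E • α, ?_⟩
    rw [happly, interR_toReal]
    funext i
    simp [toReal]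
  refine ⟨Module.reflection h2, ⟨fun x y => ?_, ?_, fun i hi => ?_, fun x => ⟨fun h => ?_, hrange x⟩,
    ?_⟩, happly⟩
  · have h3 : interForm (toReal α) (toReal α) = -2 := by
      rw [interForm_apply, interR_toReal, hα]
      norm_num
    rw [happly, happly]
    simp only [← interForm_apply] at *
    simp only [map_add, map_smul, LinearMap.add_apply, LinearMap.smul_apply, smul_eq_mul, h3]
    rw [show interForm x (toReal α) = interForm (toReal α) x from interR_comm _ _]
    ring
  · rw [happly, hKα, zero_smul, add_zero]
  · have hi0 : i ≠ 0 := by rintro rfl; simp at hi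
    rw [happly, interR_comm, interR_single hi0, toReal, hr i hi]
    simp
  · simpa only [hinv] using hrange _ h
  · rw [sq, ← map_mul, show Module.reflection h2 * Module.reflection h2 = 1 from
      LinearEquiv.ext hinv, map_one]

theorem toReal_sub (E F : Fin (8 + 1) → ℤ) : toReal (E - F) = toReal E - toReal F := by
  funext i
  simp [toReal]

/-- The Weyl group of `S_r` acts transitively on the `(-1)`-classes when `3 ≤ r`. -/
theorem exists_mem_weylGroup_apply_eq_single {r : Fin (8 + 1)} (hr : 3 ≤ r)
    {E : Fin (8 + 1) → ℤ} (hE : E ∈ classesUpTo r) :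
    ∃ g ∈ weylGroup r, g (toReal E) = toReal (Pi.single r 1) := by
  have hr0 : r ≠ 0 := by rintro rfl; exact absurd hr (by decide)
  induction hn : (1 - E r).toNat using Nat.strong_induction_on generalizing E with
  | _ n ih =>
  have hE' := mem_classesUpTo.1 hE
  obtain ⟨h1, h2⟩ := hE'.1.apply_le_one hr0
  by_cases hEr : E r = 1
  · exact ⟨1, one_mem _, by rw [h2 hEr]; rfl⟩
  obtain ⟨F, hF, hEF, hlt⟩ := exists_orthogonal_of_mem_classesUpTo hr hE hEr
  have hF' := mem_classesUpTo.1 hF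
  obtain ⟨g, hg, hgF⟩ := ih _ (by omega) hF rfl
  have hFE : interZ F E = 0 := by rw [interZ_comm, hEF]
  obtain ⟨s, hs, hsE⟩ := exists_reflection_mem_weylGroup (r := r) (α := E - F)
    (by rw [interZ_sub_left, interZ_comm E, interZ_comm F, interZ_sub_left, interZ_sub_left,
          hFE, hEF, hE'.1.1, hF'.1.1]; norm_num)
    (by rw [interZ_comm, interZ_sub_left, interZ_comm E, interZ_comm F, hE'.1.2, hF'.1.2, sub_self])
    (fun i hi => by rw [Pi.sub_apply, hE'.2 i hi, hF'.2 i hi, sub_zero])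
  refine ⟨g * s, mul_mem hg hs, ?_⟩
  have hval : interR (toReal (E - F)) (toReal E) = -1 := by
    rw [interR_toReal, interZ_sub_left, hFE, hE'.1.1]
    norm_num
  rw [LinearEquiv.mul_apply, hsE, hval, toReal_sub, ← hgF]
  congr 1
  module

/-- The multiplicity `-x_i = B(E_i, x)` for `1 ≤ i ≤ 8`, and `0` beyond. -/
def mult (x : Fin (8 + 1) → ℝ) (i : ℕ) : ℝ := if h : i < 8 + 1 then -x ⟨i, h⟩ else 0

theorem mult_apply_of_mem_weylGroup {r i : ℕ} (hi : r < i)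
    {g : (Fin (8 + 1) → ℝ) ≃ₗ[ℝ] (Fin (8 + 1) → ℝ)} (hg : g ∈ weylGroup r)
    (x : Fin (8 + 1) → ℝ) : mult (g x) i = mult x i := by
  by_cases h : i < 8 + 1
  · have h0 : (⟨i, h⟩ : Fin (8 + 1)) ≠ 0 := by
      intro h'
      have := congrArg Fin.val h'
      simp at this
      omega
    rw [mult, mult, dif_pos h, dif_pos h, ← interR_single h0, ← interR_single h0,
      ← hg.1 _ x, hg.2.2.1 ⟨i, h⟩ hi]
  · rw [mult, mult, dif_neg h, dif_neg h]

theorem interR_toReal_single {r : ℕ} (h0 : 0 < r) (h8 : r < 8 + 1) (x : Fin (8 + 1) → ℝ) :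
    interR (toReal (Pi.single ⟨r, h8⟩ 1)) x = mult x r := by
  have h : (⟨r, h8⟩ : Fin (8 + 1)) ≠ 0 := by
    intro h'
    have := congrArg Fin.val h'
    simp at this
    omega
  rw [toReal_single, interR_single h, mult, dif_pos h8]

theorem single_mem_classesUpTo {r s : ℕ} (h0 : 0 < r) (h8 : r < 8 + 1) (hrs : r ≤ s) :
    (Pi.single ⟨r, h8⟩ 1 : Fin (8 + 1) → ℤ) ∈ classesUpTo s := by
  rw [mem_classesUpTo]
  refine ⟨?_, fun i hi => Pi.single_eq_of_ne ?_ _⟩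
  · have key : ∀ i : Fin (8 + 1), i ≠ 0 → IsMinusOneClass (Pi.single i 1) := by decide +kernel
    exact key _ (by simp [Fin.ext_iff]; omega)
  · rintro rfl
    simp at hi
    omega

/-- The real vectors of anticanonical degree at most `1` that can be written as
`∑_{i > r} t_i (-K_i) + y` with `t_i ≥ 0` and `y` in the nef cone of `S_r`. -/
def flagRegion (r : ℕ) : Set (Fin (8 + 1) → ℝ) :=
  {x | interR (antiKR 8) x ≤ 1 ∧ (∀ i, r < i → mult x (i + 1) ≤ mult x i) ∧
    ∀ E ∈ classesUpTo r, mult x (r + 1) ≤ interR (toReal E) x}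

theorem apply_mem_flagRegion {r : ℕ} {g : (Fin (8 + 1) → ℝ) ≃ₗ[ℝ] (Fin (8 + 1) → ℝ)}
    (hg : g ∈ weylGroup r) {x : Fin (8 + 1) → ℝ} (hx : x ∈ flagRegion r) :
    g x ∈ flagRegion r := by
  obtain ⟨h1, h2, h3⟩ := hx
  refine ⟨?_, fun i hi => ?_, fun E hE => ?_⟩
  · rwa [← hg.2.1, hg.1]
  · rw [mult_apply_of_mem_weylGroup hi hg, mult_apply_of_mem_weylGroup (by omega) hg]
    exact h2 i hi
  · obtain ⟨F, hF, hFE⟩ := exists_mem_classesUpTo_interR_eq hg hE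
    rw [mult_apply_of_mem_weylGroup (by omega) hg, hFE]
    exact h3 F hF

theorem apply_mem_flagRegion_iff {r : ℕ} {g : (Fin (8 + 1) → ℝ) ≃ₗ[ℝ] (Fin (8 + 1) → ℝ)}
    (hg : g ∈ weylGroup r) {x : Fin (8 + 1) → ℝ} : g x ∈ flagRegion r ↔ x ∈ flagRegion r := by
  refine ⟨fun h => ?_, apply_mem_flagRegion hg⟩
  have hback := apply_mem_flagRegion (inv_mem hg) h
  rwa [show g⁻¹ (g x) = x from g.symm_apply_apply x] at hback

/-- The part of `flagRegion r` on which `E` has the smallest pairing among the classes of `S_r`. -/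
def flagPiece (r : ℕ) (E : Fin (8 + 1) → ℤ) : Set (Fin (8 + 1) → ℝ) :=
  {x | x ∈ flagRegion r ∧ ∀ F ∈ classesUpTo r, interR (toReal E) x ≤ interR (toReal F) x}

theorem apply_mem_flagPiece {r : ℕ} {g : (Fin (8 + 1) → ℝ) ≃ₗ[ℝ] (Fin (8 + 1) → ℝ)}
    (hg : g ∈ weylGroup r) {E F : Fin (8 + 1) → ℤ} (hEF : g (toReal E) = toReal F)
    {x : Fin (8 + 1) → ℝ} (hx : x ∈ flagPiece r E) : g x ∈ flagPiece r F := by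
  refine ⟨apply_mem_flagRegion hg hx.1, fun G hG => ?_⟩
  obtain ⟨G', hG', h⟩ := exists_mem_classesUpTo_interR_eq hg hG
  rw [← hEF, hg.1, h]
  exact hx.2 G' hG'

theorem volume_flagPiece_eq {r : ℕ} {g : (Fin (8 + 1) → ℝ) ≃ₗ[ℝ] (Fin (8 + 1) → ℝ)}
    (hg : g ∈ weylGroup r) {E F : Fin (8 + 1) → ℤ} (hEF : g (toReal E) = toReal F) :
    volume (flagPiece r E) = volume (flagPiece r F) := by
  rw [← volume_preimage_of_mem_weylGroup hg (flagPiece r F)]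
  congr 1
  ext x
  refine ⟨apply_mem_flagPiece hg hEF, fun h => ?_⟩
  have hback := apply_mem_flagPiece (inv_mem hg) (E := F) (F := E)
    (by rw [← hEF]; exact g.symm_apply_apply _) h
  rwa [show g⁻¹ (g x) = x from g.symm_apply_apply x] at hback

/-- The fundamental chamber of the Weyl group of `S_8`. -/
def chamber : Set (Fin (8 + 1) → ℝ) :=
  {x | mult x 1 + mult x 2 + mult x 3 ≤ x 0 ∧ ∀ i, 1 ≤ i → mult x (i + 1) ≤ mult x i}

theorem interR_expand (x y : Fin (8 + 1) → ℝ) : interR x y = x 0 * y 0 + x 1 * mult y 1 +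
    x 2 * mult y 2 + x 3 * mult y 3 + x 4 * mult y 4 + x 5 * mult y 5 + x 6 * mult y 6 +
    x 7 * mult y 7 + x 8 * mult y 8 := by
  simp only [interR, mult, Fin.sum_univ_succ]
  simp
  ring

/-- On the fundamental chamber, `E_r` has the smallest pairing among the classes of `S_r`. -/
theorem mult_le_interR_of_mem_chamber {x : Fin (8 + 1) → ℝ} (hx : x ∈ chamber) {r : ℕ}
    (h3 : 3 ≤ r) (h8 : r ≤ 8) {E : Fin (8 + 1) → ℤ} (hE : E ∈ classesUpTo r) :
    mult x r ≤ interR (toReal E) x := by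
  obtain ⟨hE1, hE2⟩ := mem_classesUpTo.1 hE
  obtain ⟨w0, w1, w2, w3, w4, w5, w6, w7⟩ := hE1.weight_nonneg
  have hK := ((isMinusOneClass_iff E).1 hE1).2
  rw [interR_comm, interR_expand] at hK
  obtain ⟨u0, hu⟩ := hx
  have u1 := hu 1 le_rfl
  have u2 := hu 2 (by norm_num)
  have u3 := hu 3 (by norm_num)
  have u4 := hu 4 (by norm_num)
  have u5 := hu 5 (by norm_num)
  have u6 := hu 6 (by norm_num)
  have u7 := hu 7 (by norm_num)
  have hKm : ∀ i, 1 ≤ i → i ≤ 8 → mult (antiKR 8) i = 1 := by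
    intro i h1 h2
    interval_cases i <;> simp [mult, antiKR]
  rw [hKm 1, hKm 2, hKm 3, hKm 4, hKm 5, hKm 6, hKm 7, hKm 8] at hK <;> try norm_num
  rw [show antiKR 8 0 = 3 from if_pos rfl] at hK
  rw [interR_expand]
  have z : ∀ i : Fin (8 + 1), r < i → toReal E i = 0 := fun i hi => by
    rw [toReal, hE2 i hi, Int.cast_zero]
  have c : ∀ i : Fin (8 + 1), (E i : ℝ) = toReal E i := fun i => rfl
  rify at w0 w1 w2 w3 w4 w5 w6 w7
  simp only [c] at w0 w1 w2 w3 w4 w5 w6 w7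
  generalize toReal E = e at *
  have z8 : r ≤ 7 → e 8 = 0 := fun h => z 8 (by change r < 8; omega)
  have z7 : r ≤ 6 → e 7 = 0 := fun h => z 7 (by change r < 7; omega)
  have z6 : r ≤ 5 → e 6 = 0 := fun h => z 6 (by change r < 6; omega)
  have z5 : r ≤ 4 → e 5 = 0 := fun h => z 5 (by change r < 5; omega)
  have z4 : r ≤ 3 → e 4 = 0 := fun h => z 4 (by change r < 4; omega)
  have v7 : (if r ≤ 7 then (1 : ℝ) else 0) ≤
      3 * e 0 + e 1 + e 2 + e 3 + e 4 + e 5 + e 6 + e 7 := by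
    split_ifs with h
    · linarith [z8 h]
    · exact w7
  have v6 : (if r ≤ 6 then (1 : ℝ) else 0) ≤ 3 * e 0 + e 1 + e 2 + e 3 + e 4 + e 5 + e 6 := by
    split_ifs with h
    · linarith [z8 (by omega), z7 h]
    · exact w6
  have v5 : (if r ≤ 5 then (1 : ℝ) else 0) ≤ 3 * e 0 + e 1 + e 2 + e 3 + e 4 + e 5 := by
    split_ifs with h
    · linarith [z8 (by omega), z7 (by omega), z6 h]
    · exact w5
  have v4 : (if r ≤ 4 then (1 : ℝ) else 0) ≤ 3 * e 0 + e 1 + e 2 + e 3 + e 4 := by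
    split_ifs with h
    · linarith [z8 (by omega), z7 (by omega), z6 (by omega), z5 h]
    · exact w4
  have v3 : (if r ≤ 3 then (1 : ℝ) else 0) ≤ 3 * e 0 + e 1 + e 2 + e 3 := by
    split_ifs with h
    · linarith [z8 (by omega), z7 (by omega), z6 (by omega), z5 (by omega), z4 h]
    · exact w3
  have p0 := mul_nonneg w0 (sub_nonneg.2 u0)
  have p1 := mul_nonneg w1 (sub_nonneg.2 u1)
  have p2 := mul_nonneg w2 (sub_nonneg.2 u2)
  have p3 := mul_nonneg (sub_nonneg.2 v3) (sub_nonneg.2 u3)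
  have p4 := mul_nonneg (sub_nonneg.2 v4) (sub_nonneg.2 u4)
  have p5 := mul_nonneg (sub_nonneg.2 v5) (sub_nonneg.2 u5)
  have p6 := mul_nonneg (sub_nonneg.2 v6) (sub_nonneg.2 u6)
  have p7 := mul_nonneg (sub_nonneg.2 v7) (sub_nonneg.2 u7)
  have p8 : (3 * e 0 + e 1 + e 2 + e 3 + e 4 + e 5 + e 6 + e 7 + e 8) * mult x 8 = mult x 8 := by
    linear_combination mult x 8 * hK
  clear z hE hE1 hE2 hu hKm c
  interval_cases r <;> norm_num at p3 p4 p5 p6 p7 <;> linarith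

/-- The Weyl group of `S_2` contains the exchange of `E_1` and `E_2`. -/
theorem exists_swap_mem_weylGroup : ∃ g ∈ weylGroup 2, ∀ x, (g x) 0 = x 0 ∧
    mult (g x) 1 = mult x 2 ∧ mult (g x) 2 = mult x 1 := by
  obtain ⟨g, hg, h⟩ := exists_reflection_mem_weylGroup (r := 2)
    (α := ![0, 1, -1, 0, 0, 0, 0, 0, 0]) (by decide) (by decide) (by decide)
  refine ⟨g, hg, fun x => ?_⟩
  have hα : interR (toReal ![0, 1, -1, 0, 0, 0, 0, 0, 0]) x = mult x 1 - mult x 2 := by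
    rw [interR_expand]
    simp [toReal]
    ring
  rw [h, hα]
  refine ⟨?_, ?_, ?_⟩
  · simp [toReal]
  · simp [toReal, mult]
  · simp [toReal, mult]

theorem mem_flagRegion_two_and_iff {x : Fin (8 + 1) → ℝ} :
    x ∈ flagRegion 2 ∧ mult x 2 ≤ mult x 1 ↔ x ∈ chamber ∧ interR (antiKR 8) x ≤ 1 := by
  constructor
  · rintro ⟨⟨h1, h2, h3⟩, h4⟩
    have hL : (![1, -1, -1, 0, 0, 0, 0, 0, 0] : Fin (8 + 1) → ℤ) ∈ classesUpTo 2 := by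
      rw [mem_classesUpTo]
      decide
    have hL' := h3 _ hL
    have hE := h3 _ (single_mem_classesUpTo two_pos (by norm_num : 2 < 8 + 1) le_rfl)
    rw [interR_toReal_single two_pos] at hE
    rw [interR_expand] at hL'
    simp [toReal] at hL'
    refine ⟨⟨by linarith, fun i hi => ?_⟩, h1⟩
    rcases lt_or_ge 2 i with h | h
    · exact h2 i h
    · interval_cases i
      · exact h4
      · exact hE
  · rintro ⟨hx, h1⟩
    exact ⟨⟨h1, fun i hi => hx.2 i (by omega), fun E hE => mult_le_interR_of_mem_chamber hx le_rfl
      (by norm_num) (classesUpTo_mono (by norm_num) hE)⟩, hx.2 1 le_rfl⟩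

theorem classesUpTo_nonempty {r : ℕ} (h1 : 1 ≤ r) : (classesUpTo r).Nonempty :=
  ⟨_, single_mem_classesUpTo one_pos (by norm_num : 1 < 8 + 1) h1⟩

theorem exists_mem_flagPiece {r : ℕ} (h1 : 1 ≤ r) {x : Fin (8 + 1) → ℝ} (hx : x ∈ flagRegion r) :
    ∃ E ∈ classesUpTo r, x ∈ flagPiece r E := by
  obtain ⟨E, hE, hmin⟩ := Finset.exists_min_image (classesUpTo r)
    (fun E => interR (toReal E) x) (classesUpTo_nonempty h1)
  exact ⟨E, hE, hx, hmin⟩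

theorem flagPiece_single_subset {r : ℕ} (h8 : r < 8) :
    flagPiece (r + 1) (Pi.single ⟨r + 1, by omega⟩ 1) ⊆ flagRegion r := by
  rintro x ⟨⟨h1, h2, h3⟩, h4⟩
  rw [interR_toReal_single (by omega)] at h4
  refine ⟨h1, fun i hi => ?_, fun E hE => h4 E (classesUpTo_mono r.le_succ hE)⟩
  rcases Nat.lt_or_eq_of_le (Nat.succ_le_of_lt hi) with hi | rfl
  · exact h2 i hi
  · have := h3 _ (single_mem_classesUpTo (by omega) (by omega : r + 1 < 8 + 1) le_rfl)
    rwa [interR_toReal_single (by omega)] at this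

/-- Every point of `flagRegion r` is moved into the fundamental chamber by the Weyl group. -/
theorem exists_apply_mem_chamber {r : ℕ} (h2 : 2 ≤ r) (h8 : r ≤ 8) {x : Fin (8 + 1) → ℝ}
    (hx : x ∈ flagRegion r) : ∃ g ∈ weylGroup r, g x ∈ chamber := by
  induction r, h2 using Nat.le_induction generalizing x with
  | base =>
    rcases le_total (mult x 2) (mult x 1) with h | h
    · exact ⟨1, one_mem _, (mem_flagRegion_two_and_iff.1 ⟨hx, h⟩).1⟩
    · obtain ⟨g, hg, hgx⟩ := exists_swap_mem_weylGroup
      refine ⟨g, hg, (mem_flagRegion_two_and_iff.1 ⟨apply_mem_flagRegion hg hx, ?_⟩).1⟩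
      rwa [(hgx x).2.1, (hgx x).2.2]
  | succ r h2 ih =>
    obtain ⟨E, hE, hxE⟩ := exists_mem_flagPiece (by omega) hx
    obtain ⟨g, hg, hgE⟩ := exists_mem_weylGroup_apply_eq_single
      (r := ⟨r + 1, by omega⟩) (Fin.le_def.2 (by change 3 ≤ r + 1; omega)) hE
    obtain ⟨g', hg', hgx⟩ := ih (by omega)
      (flagPiece_single_subset (by omega) (apply_mem_flagPiece hg hgE hxE))
    exact ⟨g' * g, mul_mem (weylGroup_mono r.le_succ hg') hg, hgx⟩

theorem flagPiece_single {r : ℕ} (h2 : 2 ≤ r) (h8 : r < 8) :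
    flagPiece (r + 1) (Pi.single ⟨r + 1, by omega⟩ 1) = flagRegion r := by
  refine (flagPiece_single_subset h8).antisymm fun x hx => ?_
  obtain ⟨g, hg, hgx⟩ := exists_apply_mem_chamber h2 h8.le hx
  have key : ∀ E ∈ classesUpTo (r + 1), mult x (r + 1) ≤ interR (toReal E) x := by
    intro E hE
    obtain ⟨F, hF, hFE⟩ := exists_mem_classesUpTo_of_mem_weylGroup
      (weylGroup_mono r.le_succ hg) hE
    rw [← hg.1, ← hFE, ← mult_apply_of_mem_weylGroup r.lt_succ_self hg]
    exact mult_le_interR_of_mem_chamber hgx (by omega) (by omega) hF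
  refine ⟨⟨hx.1, fun i hi => hx.2.1 i (by omega), fun E hE =>
    (hx.2.1 (r + 1) r.lt_succ_self).trans (key E hE)⟩, fun E hE => ?_⟩
  rw [interR_toReal_single (by omega)]
  exact key E hE

theorem volume_simplex (n : ℕ) {t : ℝ} (ht : 0 ≤ t) :
    volume {x : Fin n → ℝ | (∀ i, 0 ≤ x i) ∧ ∑ i, x i ≤ t} =
      ENNReal.ofReal (t ^ n / n.factorial) := by
  induction n generalizing t with
  | zero => simp [ht, volume_pi]
  | succ n ih =>
    have hT : MeasurableSet {p : ℝ × (Fin n → ℝ) |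
        0 ≤ p.1 ∧ (∀ i, 0 ≤ p.2 i) ∧ p.1 + ∑ i, p.2 i ≤ t} := by
      refine IsClosed.measurableSet ?_
      simp only [Set.ofPred_and, Set.ofPred_forall]
      refine (isClosed_le (by fun_prop) (by fun_prop)).inter ((isClosed_iInter fun i =>
        isClosed_le (by fun_prop) (by fun_prop)).inter (isClosed_le (by fun_prop) (by fun_prop)))
    have hpre := (volume_preserving_piFinSuccAbove (fun _ : Fin (n + 1) => ℝ) 0).measure_preimage
      hT.nullMeasurableSet
    have hset : MeasurableEquiv.piFinSuccAbove (fun _ : Fin (n + 1) => ℝ) 0 ⁻¹'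
        {p : ℝ × (Fin n → ℝ) | 0 ≤ p.1 ∧ (∀ i, 0 ≤ p.2 i) ∧ p.1 + ∑ i, p.2 i ≤ t} =
        {x : Fin (n + 1) → ℝ | (∀ i, 0 ≤ x i) ∧ ∑ i, x i ≤ t} := by
      ext x
      simp [MeasurableEquiv.piFinSuccAbove, Fin.insertNthEquiv, Fin.forall_fin_succ,
        Fin.sum_univ_succ, Fin.tail, and_assoc]
    have hfib : ∀ a : ℝ, volume (Prod.mk a ⁻¹' {p : ℝ × (Fin n → ℝ) |
        0 ≤ p.1 ∧ (∀ i, 0 ≤ p.2 i) ∧ p.1 + ∑ i, p.2 i ≤ t}) =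
        (Set.Icc 0 t).indicator (fun a => ENNReal.ofReal ((t - a) ^ n / n.factorial)) a := by
      intro a
      by_cases ha : a ∈ Set.Icc 0 t
      · rw [Set.indicator_of_mem ha, ← ih (sub_nonneg.2 ha.2)]
        congr 1
        ext x
        simp [ha.1, le_sub_iff_add_le']
      · rw [Set.indicator_of_notMem ha, ← measure_empty (μ := (volume : Measure (Fin n → ℝ)))]
        congr 1
        ext x
        simp only [Set.mem_preimage, Set.mem_ofPred_eq, Set.mem_empty_iff_false, iff_false]
        rintro ⟨h1, h2, h3⟩
        exact ha ⟨h1, by linarith [Finset.sum_nonneg fun i (_ : i ∈ Finset.univ) => h2 i]⟩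
    rw [← hset, hpre, Measure.volume_eq_prod, Measure.prod_apply hT, lintegral_congr hfib,
      lintegral_indicator measurableSet_Icc, ← ofReal_integral_eq_lintegral_ofReal]
    · congr 1
      rw [integral_Icc_eq_integral_Ioc, ← intervalIntegral.integral_of_le ht,
        intervalIntegral.integral_div, intervalIntegral.integral_comp_sub_left (fun y => y ^ n),
        integral_pow, Nat.factorial_succ]
      have := Nat.factorial_ne_zero n
      push_cast
      field_simp
      simp
    · exact (by fun_prop : Continuous fun a : ℝ => (t - a) ^ n / n.factorial).integrableOn_Icc
    · filter_upwards [ae_restrict_mem measurableSet_Icc] with a ha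
      have := sub_nonneg.2 ha.2
      positivity

theorem continuous_interR (x : Fin (8 + 1) → ℝ) : Continuous (interR x) := by
  unfold interR
  fun_prop

theorem continuous_mult (i : ℕ) : Continuous fun x => mult x i := by
  unfold mult
  split_ifs <;> fun_prop

theorem isClosed_flagRegion (r : ℕ) : IsClosed (flagRegion r) := by
  simp only [flagRegion, Set.ofPred_and, Set.ofPred_forall]
  refine (isClosed_le (continuous_interR _) continuous_const).inter (IsClosed.inter ?_ ?_)
  · exact isClosed_iInter fun i => isClosed_iInter fun _ =>
      isClosed_le (continuous_mult _) (continuous_mult _)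
  · exact isClosed_iInter fun E => isClosed_iInter fun _ =>
      isClosed_le (continuous_mult _) (continuous_interR _)

theorem isClosed_flagPiece (r : ℕ) (E : Fin (8 + 1) → ℤ) : IsClosed (flagPiece r E) := by
  simp only [flagPiece, Set.ofPred_and, Set.ofPred_forall]
  exact (isClosed_flagRegion r).inter (isClosed_iInter fun F => isClosed_iInter fun _ =>
    isClosed_le (continuous_interR _) (continuous_interR _))

theorem interR_left_injective : Function.Injective (interR : (Fin (8 + 1) → ℝ) → _) := by
  intro x y h
  funext i
  by_cases hi : i = 0
  · subst hi
    simpa [interR, Pi.single_apply, two_mul] using congrFun h (Pi.single 0 1)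
  · have := congrFun h (Pi.single i 1)
    rwa [interR_comm, interR_comm y, interR_single hi, interR_single hi, neg_inj] at this

theorem volume_interR_eq_interR {x y : Fin (8 + 1) → ℝ} (h : x ≠ y) :
    volume {z | interR x z = interR y z} = 0 := by
  have hset : {z | interR x z = interR y z} = LinearMap.ker (interForm x - interForm y) := by
    ext z
    simp [sub_eq_zero]
  rw [hset]
  refine Measure.addHaar_submodule _ _ fun htop => h (interR_left_injective (funext fun z => ?_))
  rw [LinearMap.ker_eq_top, sub_eq_zero] at htop
  exact LinearMap.congr_fun htop z

theorem volume_flagRegion_succ {r : ℕ} (h2 : 2 ≤ r) (h8 : r < 8) :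
    volume (flagRegion (r + 1)) = (classesUpTo (r + 1)).card * volume (flagRegion r) := by
  have hunion : flagRegion (r + 1) = ⋃ E ∈ classesUpTo (r + 1), flagPiece (r + 1) E := by
    ext x
    simp only [Set.mem_iUnion, exists_prop]
    exact ⟨exists_mem_flagPiece (by omega), fun ⟨E, _, hx⟩ => hx.1⟩
  have hvol : ∀ E ∈ classesUpTo (r + 1), volume (flagPiece (r + 1) E) = volume (flagRegion r) := by
    intro E hE
    obtain ⟨g, hg, hgE⟩ := exists_mem_weylGroup_apply_eq_single
      (r := ⟨r + 1, by omega⟩) (Fin.le_def.2 (by change 3 ≤ r + 1; omega)) hE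
    rw [volume_flagPiece_eq hg hgE, flagPiece_single h2 h8]
  rw [hunion, measure_biUnion_finset₀, Finset.sum_congr rfl hvol, Finset.sum_const, nsmul_eq_mul]
  · intro E hE F hF hEF
    refine measure_mono_null ?_ (volume_interR_eq_interR (toReal_injective.ne hEF))
    exact fun x ⟨h1, h2⟩ => le_antisymm (h1.2 F hF) (h2.2 E hE)
  · exact fun E _ => (isClosed_flagPiece _ E).nullMeasurableSet

theorem volume_flagRegion_two :
    volume (flagRegion 2) = 2 * volume {x | x ∈ chamber ∧ interR (antiKR 8) x ≤ 1} := by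
  obtain ⟨g, hg, h⟩ := exists_swap_mem_weylGroup
  have hunion : flagRegion 2 = {x | x ∈ flagRegion 2 ∧ mult x 2 ≤ mult x 1} ∪
      g ⁻¹' {x | x ∈ flagRegion 2 ∧ mult x 2 ≤ mult x 1} := by
    ext x
    have := le_total (mult x 2) (mult x 1)
    simp only [Set.mem_union, Set.mem_preimage, Set.mem_ofPred_eq, apply_mem_flagRegion_iff hg,
      (h x).2.1, (h x).2.2]
    tauto
  have hclosed : IsClosed {x | x ∈ flagRegion 2 ∧ mult x 2 ≤ mult x 1} :=
    (isClosed_flagRegion 2).inter (isClosed_le (continuous_mult _) (continuous_mult _))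
  have hne : (Pi.single 1 1 : Fin (8 + 1) → ℝ) ≠ Pi.single 2 1 := fun h => by
    simpa using congrFun h 1
  have hdisj : AEDisjoint volume {x | x ∈ flagRegion 2 ∧ mult x 2 ≤ mult x 1}
      (g ⁻¹' {x | x ∈ flagRegion 2 ∧ mult x 2 ≤ mult x 1}) := by
    refine measure_mono_null ?_ (volume_interR_eq_interR hne)
    rintro x ⟨⟨_, h1⟩, ⟨_, h2⟩⟩
    rw [(h x).2.1, (h x).2.2] at h2
    have h3 := le_antisymm h1 h2
    rw [Set.mem_ofPred_eq, interR_single (by decide), interR_single (by decide)]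
    exact h3.symm
  have hgcont : Continuous g := g.toLinearMap.continuous_of_finiteDimensional
  rw [hunion, measure_union₀ (hclosed.preimage hgcont).nullMeasurableSet hdisj,
    volume_preimage_of_mem_weylGroup hg, ← two_mul]
  simp only [mem_flagRegion_two_and_iff]

/-- The linear forms bounding the fundamental chamber, weighted such that their sum is the
anticanonical degree. -/
def chamberMatrix : Matrix (Fin (8 + 1)) (Fin (8 + 1)) ℤ :=
  !![3, 3, 3, 3, 0, 0, 0, 0, 0;
     0, -2, 2, 0, 0, 0, 0, 0, 0;
     0, 0, -4, 4, 0, 0, 0, 0, 0;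
     0, 0, 0, -6, 6, 0, 0, 0, 0;
     0, 0, 0, 0, -5, 5, 0, 0, 0;
     0, 0, 0, 0, 0, -4, 4, 0, 0;
     0, 0, 0, 0, 0, 0, -3, 3, 0;
     0, 0, 0, 0, 0, 0, 0, -2, 2;
     0, 0, 0, 0, 0, 0, 0, 0, -1]

theorem det_chamberMatrix : chamberMatrix.det = 17280 := by
  rw [Matrix.det_of_isUpperTriangular]
  · decide +kernel
  · intro i j h
    fin_cases i <;> fin_cases j <;> first | rfl | exact absurd h (by decide)

theorem chamber_eq_preimage : {x | x ∈ chamber ∧ interR (antiKR 8) x ≤ 1} =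
    Matrix.toLin' (chamberMatrix.map (Int.cast : ℤ → ℝ)) ⁻¹'
      {x | (∀ i, 0 ≤ x i) ∧ ∑ i, x i ≤ 1} := by
  ext x
  have hK : interR (antiKR 8) x =
      ∑ i, Matrix.toLin' (chamberMatrix.map (Int.cast : ℤ → ℝ)) x i := by
    simp [interR, antiKR, chamberMatrix, Matrix.mulVec, dotProduct, Fin.sum_univ_succ]
    ring
  have hch : x ∈ chamber ↔
      ∀ i, 0 ≤ Matrix.toLin' (chamberMatrix.map (Int.cast : ℤ → ℝ)) x i := by
    have hm : (∀ i, 1 ≤ i → mult x (i + 1) ≤ mult x i) ↔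
        ∀ i ∈ Finset.Icc 1 8, mult x (i + 1) ≤ mult x i := by
      refine ⟨fun h i hi => h i (Finset.mem_Icc.1 hi).1, fun h i hi => ?_⟩
      by_cases h8 : i ≤ 8
      · exact h i (Finset.mem_Icc.2 ⟨hi, h8⟩)
      · rw [mult, mult, dif_neg (by omega), dif_neg (by omega)]
    rw [chamber, Set.mem_ofPred_eq, hm]
    have hIcc : Finset.Icc 1 8 = {1, 2, 3, 4, 5, 6, 7, 8} := by decide
    simp only [hIcc, Finset.mem_insert, Finset.mem_singleton, forall_eq_or_imp, forall_eq,
      Fin.forall_fin_succ]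
    simp [chamberMatrix, Matrix.mulVec, dotProduct, Fin.sum_univ_succ, mult]
    intros
    constructor <;> intro <;> linarith
  rw [Set.mem_preimage, Set.mem_ofPred_eq, Set.mem_ofPred_eq, hK, hch]

theorem volume_chamber : volume {x | x ∈ chamber ∧ interR (antiKR 8) x ≤ 1} =
    ENNReal.ofReal (17280⁻¹ * (1 / (Nat.factorial 9 : ℝ))) := by
  have hdet : LinearMap.det (Matrix.toLin' (chamberMatrix.map (Int.cast : ℤ → ℝ))) = 17280 := by
    rw [LinearMap.det_toLin']
    have := Int.cast_det (R := ℝ) chamberMatrix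
    rw [← this, det_chamberMatrix]
    norm_num
  rw [chamber_eq_preimage, Measure.addHaar_preimage_linearMap _ (by rw [hdet]; norm_num), hdet,
    volume_simplex _ zero_le_one, ← ENNReal.ofReal_mul (abs_nonneg _)]
  norm_num

theorem nefRegion_eq_flagRegion : {x : Fin (8 + 1) → ℝ | x ∈ NefCone 8 ∧
    0 ≤ interR (antiKR 8) x ∧ interR (antiKR 8) x ≤ 1} = flagRegion 8 := by
  have hm : ∀ (x : Fin (8 + 1) → ℝ) i, 8 < i → mult x i = 0 := fun x i hi => dif_neg (by omega)
  ext x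
  constructor
  · rintro ⟨hx, -, h1⟩
    refine ⟨h1, fun i hi => ?_, fun E hE => ?_⟩
    · rw [hm x i hi, hm x _ (by omega)]
    · rw [hm x _ (by norm_num)]
      exact hx E (mem_classesUpTo.1 hE).1
  · rintro ⟨h1, -, h3⟩
    have hx : x ∈ NefCone 8 := fun E hE => by
      have := h3 E (mem_classesUpTo.2 ⟨hE, fun i hi => absurd i.is_lt (by omega)⟩)
      rwa [hm x _ (by norm_num)] at this
    refine ⟨hx, ?_, h1⟩
    have ha := hx (Pi.single 8 1) (by decide)
    have hb := hx ![6, -2, -2, -2, -2, -2, -2, -2, -3] (by decide)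
    have hsum : 2 * interR (antiKR 8) x = interR (toReal (Pi.single 8 1)) x +
        interR (toReal ![6, -2, -2, -2, -2, -2, -2, -2, -3]) x := by
      simp [interR, antiKR, toReal, Fin.sum_univ_succ, Pi.single_apply]
      ring
    change 0 ≤ interR (toReal _) x at ha hb
    linarith

theorem alpha_S8 :
    9 * (volume {x : Fin (8 + 1) → ℝ | x ∈ NefCone 8 ∧
      0 ≤ interR (antiKR 8) x ∧ interR (antiKR 8) x ≤ 1}).toReal = 1 := by
  rw [nefRegion_eq_flagRegion, volume_flagRegion_succ (r := 7) (by norm_num) (by norm_num),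
    volume_flagRegion_succ (r := 6) (by norm_num) (by norm_num),
    volume_flagRegion_succ (r := 5) (by norm_num) (by norm_num),
    volume_flagRegion_succ (r := 4) (by norm_num) (by norm_num),
    volume_flagRegion_succ (r := 3) (by norm_num) (by norm_num),
    volume_flagRegion_succ (r := 2) (by norm_num) (by norm_num),
    volume_flagRegion_two, volume_chamber, card_classesUpTo_three, card_classesUpTo_four,
    card_classesUpTo_five, card_classesUpTo_six, card_classesUpTo_seven, card_classesUpTo_eight]
  simp only [ENNReal.toReal_mul, ENNReal.toReal_natCast, ENNReal.toReal_ofNat]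
  rw [ENNReal.toReal_ofReal (by positivity), show Nat.factorial 9 = 362880 from rfl]
  norm_num
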